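/- Let X be a measurable space and let D_s and D_t be probability measures on X. For measurable functions f, g : X → ℝ taking values in [0,1], define ε_s(f,g) = ∫ |f − g| dD_s and ε_t(f,g) = ∫ |f − g| dD_t. Let H be a set of measurable functions X → ℝ with values in [0,1] and define d_{HΔH}(D_s, D_t) = 2 · sup_{h,h' ∈ H} |ε_t(h,h') − ε_s(h,h')|. Let y_s, y_t : X → ℝ be measurable with values in [0,1]. Then for every h ∈ H and every h* ∈ H, ε_t(h, y_t) ≤ ε_s(h, y_s) + (1/2) · d_{HΔH}(D_s, D_t) + ε_s(h*, y_s) + ε_t(h*, y_t). -/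

import Mathlib

open MeasureTheory

/-- Two measurable functions with values in `[0,1]` have an integrable distance. -/
lemma integrable_abs_sub_of_mem_Icc {X : Type*} [MeasurableSpace X]
    (μ : Measure X) [IsFiniteMeasure μ] {f g : X → ℝ}
    (hf : Measurable f) (hg : Measurable g)
    (hf01 : ∀ x, f x ∈ Set.Icc (0 : ℝ) 1) (hg01 : ∀ x, g x ∈ Set.Icc (0 : ℝ) 1) :
    Integrable (fun x => |f x - g x|) μ :=
  ((Integrable.of_mem_Icc 0 1 hf.aemeasurable (.of_forall hf01)).sub
    (Integrable.of_mem_Icc 0 1 hg.aemeasurable (.of_forall hg01))).abs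

/-- The `L¹` distance of functions with values in `[0,1]` lies in `[0,1]`. -/
lemma integral_abs_sub_mem_Icc {X : Type*} [MeasurableSpace X]
    (μ : Measure X) [IsProbabilityMeasure μ] {f g : X → ℝ}
    (hf : Measurable f) (hg : Measurable g)
    (hf01 : ∀ x, f x ∈ Set.Icc (0 : ℝ) 1) (hg01 : ∀ x, g x ∈ Set.Icc (0 : ℝ) 1) :
    ∫ x, |f x - g x| ∂μ ∈ Set.Icc (0 : ℝ) 1 := by
  refine ⟨integral_nonneg fun x => abs_nonneg _, ?_⟩
  have key : ∫ x, |f x - g x| ∂μ ≤ ∫ _, (1 : ℝ) ∂μ :=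
    integral_mono (integrable_abs_sub_of_mem_Icc μ hf hg hf01 hg01) (integrable_const 1)
      fun x => by
        obtain ⟨hf0, hf1⟩ := hf01 x
        obtain ⟨hg0, hg1⟩ := hg01 x
        exact abs_le.2 ⟨by linarith, by linarith⟩
  simpa using key

/-- Triangle inequality for the `L¹` distance of functions with values in `[0,1]`. -/
lemma integral_abs_sub_le_add {X : Type*} [MeasurableSpace X]
    (μ : Measure X) [IsFiniteMeasure μ] {f g k : X → ℝ}
    (hf : Measurable f) (hg : Measurable g) (hk : Measurable k)
    (hf01 : ∀ x, f x ∈ Set.Icc (0 : ℝ) 1) (hg01 : ∀ x, g x ∈ Set.Icc (0 : ℝ) 1)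
    (hk01 : ∀ x, k x ∈ Set.Icc (0 : ℝ) 1) :
    ∫ x, |f x - k x| ∂μ ≤ (∫ x, |f x - g x| ∂μ) + ∫ x, |g x - k x| ∂μ := by
  have hfg := integrable_abs_sub_of_mem_Icc μ hf hg hf01 hg01
  have hgk := integrable_abs_sub_of_mem_Icc μ hg hk hg01 hk01
  rw [← integral_add hfg hgk]
  exact integral_mono (integrable_abs_sub_of_mem_Icc μ hf hk hf01 hk01) (hfg.add hgk)
    fun x => abs_sub_le _ _ _

/-- Ben-David style target-error bound: for `h, h* ∈ H`,
`ε_t(h,y_t) ≤ ε_s(h,y_s) + (1/2)·d_{HΔH}(D_s,D_t) + ε_s(h*,y_s) + ε_t(h*,y_t)`. -/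
theorem target_error_bound
    {X : Type*} [MeasurableSpace X]
    (Ds Dt : Measure X) [IsProbabilityMeasure Ds] [IsProbabilityMeasure Dt]
    (H : Set (X → ℝ))
    (hHmeas : ∀ h ∈ H, Measurable h)
    (hH01 : ∀ h ∈ H, ∀ x, h x ∈ Set.Icc (0 : ℝ) 1)
    (ys yt : X → ℝ)
    (hys : Measurable ys) (hys01 : ∀ x, ys x ∈ Set.Icc (0 : ℝ) 1)
    (hyt : Measurable yt) (hyt01 : ∀ x, yt x ∈ Set.Icc (0 : ℝ) 1)
    (h : X → ℝ) (hh : h ∈ H)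
    (hstar : X → ℝ) (hhstar : hstar ∈ H) :
    (∫ x, |h x - yt x| ∂Dt)
      ≤ (∫ x, |h x - ys x| ∂Ds)
        + (1 / 2) *
            (2 * sSup {r : ℝ | ∃ h1 ∈ H, ∃ h2 ∈ H,
              r = |(∫ x, |h1 x - h2 x| ∂Dt) - (∫ x, |h1 x - h2 x| ∂Ds)|})
        + (∫ x, |hstar x - ys x| ∂Ds) + (∫ x, |hstar x - yt x| ∂Dt) := by
  have hmh := hHmeas h hh
  have hms := hHmeas hstar hhstar
  have hbdd : BddAbove {r : ℝ | ∃ h1 ∈ H, ∃ h2 ∈ H,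
      r = |(∫ x, |h1 x - h2 x| ∂Dt) - (∫ x, |h1 x - h2 x| ∂Ds)|} := by
    refine ⟨1, ?_⟩
    rintro _ ⟨h1, hh1, h2, hh2, rfl⟩
    obtain ⟨ht0, ht1⟩ := integral_abs_sub_mem_Icc Dt (hHmeas h1 hh1) (hHmeas h2 hh2)
      (hH01 h1 hh1) (hH01 h2 hh2)
    obtain ⟨hs0, hs1⟩ := integral_abs_sub_mem_Icc Ds (hHmeas h1 hh1) (hHmeas h2 hh2)
      (hH01 h1 hh1) (hH01 h2 hh2)
    exact abs_le.2 ⟨by linarith, by linarith⟩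
  have hdisc := (le_abs_self _).trans (le_csSup hbdd ⟨h, hh, hstar, hhstar, rfl⟩)
  have htarget := integral_abs_sub_le_add Dt hmh hms hyt (hH01 h hh) (hH01 hstar hhstar) hyt01
  have hsource := integral_abs_sub_le_add Ds hmh hys hms (hH01 h hh) hys01 (hH01 hstar hhstar)
  simp only [abs_sub_comm (ys _) (hstar _)] at hsource
  linarith
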